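/- arXiv:2507.04328 — 2 statements merged into one kernel-verified Lean document; each statement's English description precedes it below -/
import Mathlib

section
/- Let 0 < β < α < 1, let x₀ ∈ Ω̄, and define ψ(x) = |x − x₀|^β. Then for every x ∈ Ω with x ≠ x₀, L[ψ](x) ≤ |x − x₀|^{β−α}·((r⋆^β − 1)/(r⋆ − 1)^α − 1) < 0, where r⋆ is the unique solution in (1, ∞) of (α − β)r^β + β r^{β−1} − α = 0. -/
open Set Metric

/-- The fractional sup-operator `L⁺[u](x)`. -/
noncomputable def Lplus {n : ℕ} (Ω : Set (EuclideanSpace ℝ (Fin n))) (α : ℝ)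
    (u : EuclideanSpace ℝ (Fin n) → ℝ) (x : EuclideanSpace ℝ (Fin n)) : ℝ :=
  sSup ((fun y => (u y - u x) / ‖y - x‖ ^ α) '' (closure Ω \ {x}))

/-- The fractional inf-operator `L⁻[u](x)`. -/
noncomputable def Lminus {n : ℕ} (Ω : Set (EuclideanSpace ℝ (Fin n))) (α : ℝ)
    (u : EuclideanSpace ℝ (Fin n) → ℝ) (x : EuclideanSpace ℝ (Fin n)) : ℝ :=
  sInf ((fun y => (u y - u x) / ‖y - x‖ ^ α) '' (closure Ω \ {x}))

/-- The fractional infinity Laplacian `L[u](x) = L⁺[u](x) + L⁻[u](x)`. -/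
noncomputable def Lop {n : ℕ} (Ω : Set (EuclideanSpace ℝ (Fin n))) (α : ℝ)
    (u : EuclideanSpace ℝ (Fin n) → ℝ) (x : EuclideanSpace ℝ (Fin n)) : ℝ :=
  Lplus Ω α u x + Lminus Ω α u x

/-- On `[1, ∞)` the function `r ↦ (α - β) r ^ β + β r ^ (β - 1) - α`, which vanishes at `1`
and at `rs`, is nonpositive up to `rs` and nonnegative afterwards. -/
theorem critical_sign {α β rs r : ℝ} (hβ0 : 0 < β) (hβα : β < α) (hα1 : α < 1) (hrs : 1 < rs)
    (heq : (α - β) * rs ^ β + β * rs ^ (β - 1) - α = 0) (hr : 1 < r) :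
    (r ≤ rs → (α - β) * r ^ β + β * r ^ (β - 1) - α ≤ 0) ∧
      (rs ≤ r → 0 ≤ (α - β) * r ^ β + β * r ^ (β - 1) - α) := by
  have hfac : ∀ s : ℝ, 0 < s → (α - β) * s ^ β + β * s ^ (β - 1) - α
      = s ^ (β - 1) * ((α - β) * s + β - α * s ^ (1 - β)) := by
    intro s hs
    have h₁ : s ^ β = s ^ (β - 1) * s := by
      rw [← Real.rpow_add_one hs.ne']; congr 1; ring
    have h₂ : s ^ (β - 1) * s ^ (1 - β) = 1 := by
      rw [← Real.rpow_add hs]; simp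
    rw [h₁]; linear_combination α * h₂
  have hconc : ConcaveOn ℝ (Ici 0) fun s : ℝ => s ^ (1 - β) :=
    Real.concaveOn_rpow (by linarith) (by linarith)
  have hzero : (α - β) * rs + β = α * rs ^ (1 - β) := by
    rw [hfac rs (by linarith)] at heq
    have := (mul_eq_zero.1 heq).resolve_left (Real.rpow_pos_of_pos (by linarith) _).ne'
    linarith
  have hpos : 0 < r ^ (β - 1) := Real.rpow_pos_of_pos (by linarith) _
  rw [hfac r (by linarith)]
  constructor
  · intro hle
    refine mul_nonpos_of_nonneg_of_nonpos hpos.le ?_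
    rcases hle.eq_or_lt with rfl | hlt
    · linarith
    have h := hconc.slope_anti_adjacent (x := 1) (y := r) (z := rs)
      (by simp) (by simp; linarith) hr hlt
    rw [div_le_div_iff₀ (by linarith) (by linarith), Real.one_rpow] at h
    nlinarith
  · intro hle
    refine mul_nonneg hpos.le ?_
    rcases hle.eq_or_lt with rfl | hlt
    · linarith
    have h := hconc.slope_anti_adjacent (x := 1) (y := rs) (z := r)
      (by simp) (by simp; linarith) hrs hlt
    rw [div_le_div_iff₀ (by linarith) (by linarith), Real.one_rpow] at h
    nlinarith

theorem hasDerivAt_rpow_sub_one_div {α β r : ℝ} (hr : 1 < r) :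
    HasDerivAt (fun r : ℝ => (r ^ β - 1) / (r - 1) ^ α)
      (-((r - 1) ^ (α - 1) * ((α - β) * r ^ β + β * r ^ (β - 1) - α)) / ((r - 1) ^ α) ^ 2) r := by
  have hr1 : 0 < r - 1 := by linarith
  have hnum : HasDerivAt (fun r : ℝ => r ^ β - 1) (β * r ^ (β - 1)) r :=
    (Real.hasDerivAt_rpow_const (Or.inl (by linarith))).sub_const 1
  have hden : HasDerivAt (fun r : ℝ => (r - 1) ^ α) (1 * α * (r - 1) ^ (α - 1)) r :=
    ((hasDerivAt_id r).sub_const 1).rpow_const (Or.inl hr1.ne')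
  refine (hnum.fun_div hden (Real.rpow_pos_of_pos hr1 _).ne').congr_deriv ?_
  congr 1
  have h₁ : r ^ β = r ^ (β - 1) * r := by
    rw [← Real.rpow_add_one (by linarith)]; congr 1; ring
  have h₂ : (r - 1) ^ α = (r - 1) ^ (α - 1) * (r - 1) := by
    rw [← Real.rpow_add_one hr1.ne']; congr 1; ring
  rw [h₁, h₂]; ring

/-- The quotient `(r ^ β - 1) / (r - 1) ^ α` is maximal on `(1, ∞)` at its critical point. -/
theorem rpow_sub_one_div_le {α β rs r : ℝ} (hβ0 : 0 < β) (hβα : β < α) (hα1 : α < 1)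
    (hrs : 1 < rs) (heq : (α - β) * rs ^ β + β * rs ^ (β - 1) - α = 0) (hr : 1 < r) :
    (r ^ β - 1) / (r - 1) ^ α ≤ (rs ^ β - 1) / (rs - 1) ^ α := by
  rcases le_total r rs with hle | hle
  · have hgt : ∀ s ∈ Icc r rs, 1 < s := fun s hs => hr.trans_le hs.1
    refine monotoneOn_of_hasDerivWithinAt_nonneg (convex_Icc r rs)
      (fun s hs => (hasDerivAt_rpow_sub_one_div (hgt s hs)).continuousAt.continuousWithinAt)
      (fun s hs => (hasDerivAt_rpow_sub_one_div (hgt s (interior_subset hs))).hasDerivWithinAt)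
      (fun s hs => ?_) (left_mem_Icc.2 hle) (right_mem_Icc.2 hle) hle
    have hs' := interior_subset hs
    have hsign := (critical_sign hβ0 hβα hα1 hrs heq (hgt s hs')).1 hs'.2
    refine div_nonneg (neg_nonneg.2 (mul_nonpos_of_nonneg_of_nonpos ?_ hsign)) (sq_nonneg _)
    exact Real.rpow_nonneg (by linarith [hgt s hs']) _
  · have hgt : ∀ s ∈ Icc rs r, 1 < s := fun s hs => hrs.trans_le hs.1
    refine antitoneOn_of_hasDerivWithinAt_nonpos (convex_Icc rs r)
      (fun s hs => (hasDerivAt_rpow_sub_one_div (hgt s hs)).continuousAt.continuousWithinAt)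
      (fun s hs => (hasDerivAt_rpow_sub_one_div (hgt s (interior_subset hs))).hasDerivWithinAt)
      (fun s hs => ?_) (left_mem_Icc.2 hle) (right_mem_Icc.2 hle) hle
    have hs' := interior_subset hs
    have hsign := (critical_sign hβ0 hβα hα1 hrs heq (hgt s hs')).2 hs'.1
    refine div_nonpos_of_nonpos_of_nonneg (neg_nonpos.2 (mul_nonneg ?_ hsign)) (sq_nonneg _)
    exact Real.rpow_nonneg (by linarith [hgt s hs']) _

theorem rpow_sub_one_div_lt_one {α β r : ℝ} (hβα : β < α) (hα0 : 0 ≤ α) (hα1 : α ≤ 1)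
    (hr : 1 < r) : (r ^ β - 1) / (r - 1) ^ α < 1 := by
  have hr1 : 0 < r - 1 := by linarith
  rw [div_lt_one (Real.rpow_pos_of_pos hr1 _)]
  have h₁ : r ^ β < r ^ α := Real.rpow_lt_rpow_of_exponent_lt hr hβα
  have h₂ := Real.rpow_add_le_add_rpow zero_le_one hr1.le hα0 hα1
  rw [Real.one_rpow, add_sub_cancel] at h₂
  linarith

theorem rpow_sub_rpow_div_eq {α β d s ρ : ℝ} (hd : 0 < d) (hs : 0 ≤ s) (hρ : 0 ≤ ρ) :
    (s ^ β - d ^ β) / ρ ^ α = d ^ (β - α) * (((s / d) ^ β - 1) / (ρ / d) ^ α) := by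
  rw [Real.div_rpow hs hd.le, Real.div_rpow hρ hd.le, Real.rpow_sub hd]
  have := (Real.rpow_pos_of_pos hd β).ne'
  have := (Real.rpow_pos_of_pos hd α).ne'
  field_simp

theorem neg_one_le_rpow_sub_one_div {α β q t : ℝ} (hβ0 : 0 ≤ β) (hβ1 : β ≤ 1) (hα0 : 0 ≤ α)
    (hα1 : α ≤ 1) (hq : 0 ≤ q) (ht : 0 < t) (hqt : 1 ≤ q + t) :
    -1 ≤ (q ^ β - 1) / t ^ α := by
  have htα := Real.rpow_pos_of_pos ht α
  rw [le_div_iff₀ htα]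
  rcases le_total 1 q with h | h
  · linarith [Real.one_le_rpow h hβ0]
  · have hqβ : q ≤ q ^ β := Real.self_le_rpow_of_le_one hq h hβ1
    rcases le_total 1 t with ht1 | ht1
    · linarith [Real.one_le_rpow ht1 hα0]
    · linarith [Real.self_le_rpow_of_le_one ht.le ht1 hα1]

/-- For `0 < β < α < 1`, `x₀ ∈ Ω̄` and `ψ(x) = ‖x − x₀‖^β`, for every
`x ∈ Ω` with `x ≠ x₀` one has
`L[ψ](x) ≤ ‖x − x₀‖^(β−α) ((rs^β − 1)/(rs − 1)^α − 1) < 0`, where `rs` is the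
unique solution in `(1,∞)` of `(α − β) r^β + β r^(β−1) − α = 0`. -/
theorem stmt_3 (n : ℕ) (hn : 1 ≤ n) (Ω : Set (EuclideanSpace ℝ (Fin n)))
    (hΩo : IsOpen Ω) (hΩne : Ω.Nonempty) (hΩb : Bornology.IsBounded Ω)
    (α β : ℝ) (hβ0 : 0 < β) (hβα : β < α) (hα1 : α < 1)
    (rs : ℝ) (hrs : 1 < rs)
    (heq : (α - β) * rs ^ β + β * rs ^ (β - 1) - α = 0)
    (x₀ : EuclideanSpace ℝ (Fin n)) (hx₀ : x₀ ∈ closure Ω)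
    (x : EuclideanSpace ℝ (Fin n)) (hx : x ∈ Ω) (hxx₀ : x ≠ x₀) :
    Lop Ω α (fun z => ‖z - x₀‖ ^ β) x ≤
      ‖x - x₀‖ ^ (β - α) * ((rs ^ β - 1) / (rs - 1) ^ α - 1) ∧
    ‖x - x₀‖ ^ (β - α) * ((rs ^ β - 1) / (rs - 1) ^ α - 1) < 0 := by
  have hd : 0 < ‖x - x₀‖ := norm_pos_iff.2 (sub_ne_zero.2 hxx₀)
  have hdpow : 0 < ‖x - x₀‖ ^ (β - α) := Real.rpow_pos_of_pos hd _
  have hα0 : 0 < α := hβ0.trans hβα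
  have hmem : x₀ ∈ closure Ω \ {x} := ⟨hx₀, fun h => hxx₀ h.symm⟩
  refine ⟨?_, mul_neg_of_pos_of_neg hdpow
    (by linarith [rpow_sub_one_div_lt_one hβα hα0.le hα1.le hrs])⟩
  have hsup : Lplus Ω α (fun z => ‖z - x₀‖ ^ β) x ≤
      ‖x - x₀‖ ^ (β - α) * ((rs ^ β - 1) / (rs - 1) ^ α) := by
    refine csSup_le (Set.Nonempty.image _ ⟨x₀, hmem⟩) ?_
    rintro _ ⟨y, ⟨-, hyx⟩, rfl⟩
    have hρ : 0 < ‖y - x‖ := norm_pos_iff.2 (sub_ne_zero.2 hyx)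
    have ht : 0 < ‖y - x‖ / ‖x - x₀‖ := div_pos hρ hd
    have htri : ‖y - x₀‖ / ‖x - x₀‖ ≤ 1 + ‖y - x‖ / ‖x - x₀‖ := by
      rw [div_le_iff₀ hd, add_mul, div_mul_cancel₀ _ hd.ne', one_mul, add_comm]
      exact norm_sub_le_norm_sub_add_norm_sub y x x₀
    have hmax := rpow_sub_one_div_le (r := 1 + ‖y - x‖ / ‖x - x₀‖) hβ0 hβα hα1 hrs heq
      (by linarith)
    rw [add_sub_cancel_left] at hmax
    beta_reduce
    rw [rpow_sub_rpow_div_eq hd (norm_nonneg _) hρ.le]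
    refine mul_le_mul_of_nonneg_left (le_trans ?_ hmax) hdpow.le
    gcongr
  have hinf : Lminus Ω α (fun z => ‖z - x₀‖ ^ β) x ≤ -‖x - x₀‖ ^ (β - α) := by
    refine csInf_le ⟨-‖x - x₀‖ ^ (β - α), ?_⟩ ⟨x₀, hmem, ?_⟩
    · rintro _ ⟨y, ⟨-, hyx⟩, rfl⟩
      have hρ : 0 < ‖y - x‖ := norm_pos_iff.2 (sub_ne_zero.2 hyx)
      have htri : 1 ≤ ‖y - x₀‖ / ‖x - x₀‖ + ‖y - x‖ / ‖x - x₀‖ := by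
        rw [← add_div, one_le_div hd, add_comm, norm_sub_rev y x]
        exact norm_sub_le_norm_sub_add_norm_sub x y x₀
      have hlow := neg_one_le_rpow_sub_one_div hβ0.le (hβα.trans hα1).le hα0.le hα1.le
        (div_nonneg (norm_nonneg (y - x₀)) hd.le) (div_pos hρ hd) htri
      beta_reduce
      rw [rpow_sub_rpow_div_eq hd (norm_nonneg _) hρ.le]
      linarith [mul_le_mul_of_nonneg_left hlow hdpow.le]
    · beta_reduce
      rw [sub_self, norm_zero, Real.zero_rpow hβ0.ne', norm_sub_rev x₀ x, Real.rpow_sub hd]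
      ring
  rw [Lop, mul_sub, mul_one]
  linarith
end

section
/- Let α ∈ (0,1] and assume f : ℝ → ℝ is continuous. Let F be a nonempty family of viscosity subsolutions of L[u] = f(u) on Ω. Define v(x) = sup{u(x) : u ∈ F} for x ∈ Ω̄ and assume v is finite everywhere, upper semicontinuous on Ω̄, and continuous on Ω. Then v is a viscosity subsolution of L[u] = f(u) on Ω. -/
open Set Metric

/-- `u` is a viscosity subsolution of `L[u] = f(u)` on `U ⊆ Ω`. -/
def IsViscositySubsolution {n : ℕ} (Ω U : Set (EuclideanSpace ℝ (Fin n))) (α : ℝ)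
    (f : ℝ → ℝ) (u : EuclideanSpace ℝ (Fin n) → ℝ) : Prop :=
  UpperSemicontinuousOn u (closure Ω) ∧
  ∀ φ : EuclideanSpace ℝ (Fin n) → ℝ,
    ContDiffOn ℝ 1 φ U → ContinuousOn φ (closure Ω) →
    (∀ x ∈ closure Ω, u x ≤ φ x) →
    ∀ x₀ ∈ U, u x₀ = φ x₀ → -Lop Ω α φ x₀ + f (φ x₀) ≤ 0

/-- `u` is a viscosity supersolution of `L[u] = f(u)` on `U ⊆ Ω`. -/
def IsViscositySupersolution {n : ℕ} (Ω U : Set (EuclideanSpace ℝ (Fin n))) (α : ℝ)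
    (f : ℝ → ℝ) (u : EuclideanSpace ℝ (Fin n) → ℝ) : Prop :=
  LowerSemicontinuousOn u (closure Ω) ∧
  ∀ φ : EuclideanSpace ℝ (Fin n) → ℝ,
    ContDiffOn ℝ 1 φ U → ContinuousOn φ (closure Ω) →
    (∀ x ∈ closure Ω, φ x ≤ u x) →
    ∀ x₀ ∈ U, u x₀ = φ x₀ → 0 ≤ -Lop Ω α φ x₀ + f (φ x₀)

/-- `u` is a strict viscosity supersolution of `L[u] = f(u)` on `U ⊆ Ω`. -/
def IsStrictViscositySupersolution {n : ℕ} (Ω U : Set (EuclideanSpace ℝ (Fin n))) (α : ℝ)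
    (f : ℝ → ℝ) (u : EuclideanSpace ℝ (Fin n) → ℝ) : Prop :=
  LowerSemicontinuousOn u (closure Ω) ∧
  ∀ φ : EuclideanSpace ℝ (Fin n) → ℝ,
    ContDiffOn ℝ 1 φ U → ContinuousOn φ (closure Ω) →
    (∀ x ∈ closure Ω, φ x ≤ u x) →
    ∀ x₀ ∈ U, u x₀ = φ x₀ → 0 < -Lop Ω α φ x₀ + f (φ x₀)

open Filter Topology

section HolderQuotient

variable {n : ℕ} {Ω : Set (EuclideanSpace ℝ (Fin n))} {α : ℝ}
  {φ : EuclideanSpace ℝ (Fin n) → ℝ} {x : EuclideanSpace ℝ (Fin n)}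

/-- A nonempty open subset of a positive-dimensional space contains a point other than `x`
in its closure. -/
lemma closure_diff_singleton_nonempty (hn : 1 ≤ n) (hΩo : IsOpen Ω) (hx : x ∈ Ω) :
    (closure Ω \ {x}).Nonempty := by
  have : Nonempty (Fin n) := ⟨⟨0, hn⟩⟩
  have h : (𝓝[≠] x).NeBot := Module.punctured_nhds_neBot ℝ _ x
  have h1 : ∀ᶠ y in 𝓝[≠] x, y ∈ Ω := nhdsWithin_le_nhds (hΩo.mem_nhds hx)
  obtain ⟨y, hy, hyx⟩ := (h1.and self_mem_nhdsWithin).exists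
  exact ⟨y, subset_closure hy, hyx⟩

lemma Lop_add_const (M : ℝ) : Lop Ω α (fun y => φ y + M) x = Lop Ω α φ x := by
  simp only [Lop, Lplus, Lminus, add_sub_add_right_eq_sub]

/-- The Hölder quotients of a function that is `C¹` near `x` are bounded above. -/
lemma bddAbove_quotient (hΩo : IsOpen Ω) (hΩb : Bornology.IsBounded Ω) (hα0 : 0 < α)
    (hα1 : α ≤ 1) (hφ : ContDiffOn ℝ 1 φ Ω) (hφc : ContinuousOn φ (closure Ω)) (hx : x ∈ Ω) :
    BddAbove ((fun y => (φ y - φ x) / ‖y - x‖ ^ α) '' (closure Ω \ {x})) := by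
  obtain ⟨M, hM⟩ := hΩb.isCompact_closure.exists_bound_of_continuousOn hφc
  have hd : DifferentiableAt ℝ φ x :=
    (hφ.contDiffAt (hΩo.mem_nhds hx)).differentiableAt one_ne_zero
  obtain ⟨C, hC⟩ := hd.isBigO_sub.bound
  obtain ⟨r, hr, hrC⟩ := Metric.eventually_nhds_iff.1 hC
  refine ⟨max |C| ((M + M) / (min r 1) ^ α), ?_⟩
  rintro _ ⟨y, ⟨hy, hyx⟩, rfl⟩
  have hpos : 0 < ‖y - x‖ := norm_pos_iff.2 (sub_ne_zero.2 hyx)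
  have hs : 0 < min r 1 := lt_min hr one_pos
  dsimp only
  by_cases hlt : ‖y - x‖ < min r 1
  · refine le_max_of_le_left ?_
    rw [div_le_iff₀ (Real.rpow_pos_of_pos hpos _)]
    have h1 := hrC (y := y) (by rw [dist_eq_norm]; exact hlt.trans_le (min_le_left _ _))
    have h2 : ‖y - x‖ ≤ ‖y - x‖ ^ α :=
      Real.self_le_rpow_of_le_one hpos.le (hlt.le.trans (min_le_right _ _)) hα1
    calc φ y - φ x ≤ ‖φ y - φ x‖ := le_abs_self _
      _ ≤ C * ‖y - x‖ := h1
      _ ≤ |C| * ‖y - x‖ := by gcongr; exact le_abs_self _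
      _ ≤ |C| * ‖y - x‖ ^ α := by gcongr
  · refine le_max_of_le_right ?_
    have h1 := abs_le.1 (hM y hy)
    have h2 := abs_le.1 (hM x (subset_closure hx))
    have h3 : min r 1 ^ α ≤ ‖y - x‖ ^ α :=
      Real.rpow_le_rpow hs.le (not_lt.1 hlt) hα0.le
    have hM0 : 0 ≤ M := (norm_nonneg _).trans (hM y hy)
    calc (φ y - φ x) / ‖y - x‖ ^ α ≤ (M + M) / ‖y - x‖ ^ α := by gcongr <;> linarith
      _ ≤ (M + M) / min r 1 ^ α := by
        have := Real.rpow_pos_of_pos hs α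
        gcongr

/-- The Hölder quotients of a function that is `C¹` near `x` are bounded below. -/
lemma bddBelow_quotient (hΩo : IsOpen Ω) (hΩb : Bornology.IsBounded Ω) (hα0 : 0 < α)
    (hα1 : α ≤ 1) (hφ : ContDiffOn ℝ 1 φ Ω) (hφc : ContinuousOn φ (closure Ω)) (hx : x ∈ Ω) :
    BddBelow ((fun y => (φ y - φ x) / ‖y - x‖ ^ α) '' (closure Ω \ {x})) := by
  obtain ⟨C, hC⟩ := bddAbove_quotient hΩo hΩb hα0 hα1 hφ.neg hφc.neg hx
  refine ⟨-C, ?_⟩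
  rintro _ ⟨y, hy, rfl⟩
  have h := hC ⟨y, hy, rfl⟩
  have e : (-φ y - -φ x) / ‖y - x‖ ^ α = -((φ y - φ x) / ‖y - x‖ ^ α) := by ring
  dsimp only [Pi.neg_apply] at h ⊢
  rw [e] at h
  linarith

lemma tendsto_quotient (hφx : ContinuousAt φ x) {y : EuclideanSpace ℝ (Fin n)}
    (hφy : ContinuousWithinAt φ (closure Ω) y) (hyx : y ≠ x) :
    Tendsto (fun z : EuclideanSpace ℝ (Fin n) × EuclideanSpace ℝ (Fin n) =>
      (φ z.2 - φ z.1) / ‖z.2 - z.1‖ ^ α) (𝓝 x ×ˢ 𝓝[closure Ω] y)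
      (𝓝 ((φ y - φ x) / ‖y - x‖ ^ α)) := by
  have h1 : Tendsto Prod.fst (𝓝 x ×ˢ 𝓝[closure Ω] y) (𝓝 x) := tendsto_fst
  have h2 : Tendsto Prod.snd (𝓝 x ×ˢ 𝓝[closure Ω] y) (𝓝[closure Ω] y) := tendsto_snd
  have hne : ‖y - x‖ ≠ 0 := norm_ne_zero_iff.2 (sub_ne_zero.2 hyx)
  refine ((hφy.tendsto.comp h2).sub (hφx.tendsto.comp h1)).div
    (((h2.mono_right nhdsWithin_le_nhds).sub h1).norm.rpow_const (Or.inl hne)) ?_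
  exact (Real.rpow_pos_of_pos (norm_pos_iff.2 (sub_ne_zero.2 hyx)) _).ne'

/-- Near the diagonal, quotients are controlled by translating the pair so that it starts
at `x`. -/
lemma eventually_quotient_le_diag (hΩo : IsOpen Ω) (hΩb : Bornology.IsBounded Ω) (hα0 : 0 < α)
    (hα1 : α ≤ 1) (hφ : ContDiffOn ℝ 1 φ Ω) (hφc : ContinuousOn φ (closure Ω)) (hx : x ∈ Ω)
    {ε : ℝ} (hε : 0 < ε) :
    ∀ᶠ z : EuclideanSpace ℝ (Fin n) × EuclideanSpace ℝ (Fin n) in 𝓝 (x, x), z.2 ≠ z.1 →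
      (φ z.2 - φ z.1) / ‖z.2 - z.1‖ ^ α ≤ Lplus Ω α φ x + ε := by
  have hs : HasStrictFDerivAt φ (fderiv ℝ φ x) x :=
    (hφ.contDiffAt (hΩo.mem_nhds hx)).hasStrictFDerivAt one_ne_zero
  have hb := (hs.isLittleO.def (half_pos hε))
  have ht : Tendsto (fun z : EuclideanSpace ℝ (Fin n) × EuclideanSpace ℝ (Fin n) =>
      x + (z.2 - z.1)) (𝓝 (x, x)) (𝓝 x) := by
    have : Continuous (fun z : EuclideanSpace ℝ (Fin n) × EuclideanSpace ℝ (Fin n) =>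
      x + (z.2 - z.1)) := by fun_prop
    simpa using this.tendsto (x, x)
  have hswap : Tendsto (fun z : EuclideanSpace ℝ (Fin n) × EuclideanSpace ℝ (Fin n) =>
      (z.2, z.1)) (𝓝 (x, x)) (𝓝 (x, x)) :=
    (continuous_snd.prodMk continuous_fst).tendsto (x, x)
  have ht2 : Tendsto (fun z : EuclideanSpace ℝ (Fin n) × EuclideanSpace ℝ (Fin n) =>
      (x + (z.2 - z.1), x)) (𝓝 (x, x)) (𝓝 (x, x)) := ht.prodMk_nhds tendsto_const_nhds
  filter_upwards [hswap.eventually hb, ht2.eventually hb, ht.eventually (hΩo.mem_nhds hx),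
    ht.eventually (Metric.ball_mem_nhds x one_pos)] with z h1 h2 h3 h4 hne
  have hpos : 0 < ‖z.2 - z.1‖ := norm_pos_iff.2 (sub_ne_zero.2 hne)
  have hle1 : ‖z.2 - z.1‖ ≤ 1 := by
    have := (mem_ball.1 h4).le
    simpa [dist_eq_norm] using this
  have hpow : ‖z.2 - z.1‖ ≤ ‖z.2 - z.1‖ ^ α := Real.self_le_rpow_of_le_one hpos.le hle1 hα1
  have hppos := Real.rpow_pos_of_pos hpos α
  have hq : (φ (x + (z.2 - z.1)) - φ x) / ‖z.2 - z.1‖ ^ α ≤ Lplus Ω α φ x := by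
    refine le_csSup (bddAbove_quotient hΩo hΩb hα0 hα1 hφ hφc hx)
      ⟨x + (z.2 - z.1), ⟨subset_closure h3, ?_⟩, ?_⟩
    · simpa [sub_eq_zero] using hne
    · simp
  rw [div_le_iff₀ hppos] at hq ⊢
  simp only [add_sub_cancel_left] at h2
  have h1' := (abs_le.1 h1).2
  have h2' := (abs_le.1 h2).1
  nlinarith

lemma eventually_Lplus_le (hn : 1 ≤ n) (hΩo : IsOpen Ω) (hΩb : Bornology.IsBounded Ω)
    (hα0 : 0 < α) (hα1 : α ≤ 1) (hφ : ContDiffOn ℝ 1 φ Ω) (hφc : ContinuousOn φ (closure Ω))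
    (hx : x ∈ Ω) {ε : ℝ} (hε : 0 < ε) :
    ∀ᶠ x' in 𝓝 x, Lplus Ω α φ x' ≤ Lplus Ω α φ x + ε := by
  have key : ∀ᶠ x' in 𝓝 x, ∀ y ∈ closure Ω, y ∈ closure Ω → y ≠ x' →
      (φ y - φ x') / ‖y - x'‖ ^ α ≤ Lplus Ω α φ x + ε := by
    refine hΩb.isCompact_closure.eventually_forall_of_forall_eventually fun y hy => ?_
    by_cases hyx : y = x
    · subst hyx
      filter_upwards [eventually_quotient_le_diag hΩo hΩb hα0 hα1 hφ hφc hx hε] with z hz _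
      exact hz
    · have hlt : (φ y - φ x) / ‖y - x‖ ^ α < Lplus Ω α φ x + ε :=
        (le_csSup (bddAbove_quotient hΩo hΩb hα0 hα1 hφ hφc hx)
          ⟨y, ⟨hy, hyx⟩, rfl⟩).trans_lt (lt_add_of_pos_right _ hε)
      have h := (tendsto_quotient (α := α) (hφ.continuousOn.continuousAt (hΩo.mem_nhds hx))
        (hφc y hy) hyx).eventually_lt_const hlt
      rw [← nhdsWithin_univ x, ← nhdsWithin_prod_eq, eventually_nhdsWithin_iff] at h
      filter_upwards [h] with z hz hzc _
      exact (hz ⟨mem_univ _, hzc⟩).le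
  filter_upwards [key, hΩo.mem_nhds hx] with x' h hx'
  refine csSup_le ((closure_diff_singleton_nonempty hn hΩo hx').image _) ?_
  rintro _ ⟨y, ⟨hy, hyx⟩, rfl⟩
  exact h y hy hy hyx

lemma eventually_Lminus_lt (hn : 1 ≤ n) (hΩo : IsOpen Ω) (hΩb : Bornology.IsBounded Ω)
    (hα0 : 0 < α) (hα1 : α ≤ 1) (hφ : ContDiffOn ℝ 1 φ Ω) (hφc : ContinuousOn φ (closure Ω))
    (hx : x ∈ Ω) {ε : ℝ} (hε : 0 < ε) :
    ∀ᶠ x' in 𝓝 x, Lminus Ω α φ x' < Lminus Ω α φ x + ε := by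
  obtain ⟨_, ⟨y, ⟨hy, hyx⟩, rfl⟩, hlt⟩ := exists_lt_of_csInf_lt
    ((closure_diff_singleton_nonempty hn hΩo hx).image _)
    (lt_add_of_pos_right (Lminus Ω α φ x) hε)
  have hyx : y ≠ x := hyx
  have ht : Tendsto (fun x' => (x', y)) (𝓝 x) (𝓝 x ×ˢ 𝓝[closure Ω] y) :=
    tendsto_id.prodMk (tendsto_const_pure.mono_right (pure_le_nhdsWithin hy))
  have h := ((tendsto_quotient (α := α) (hφ.continuousOn.continuousAt (hΩo.mem_nhds hx))
    (hφc y hy) hyx).comp ht).eventually_lt_const hlt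
  filter_upwards [h, hΩo.mem_nhds hx, isOpen_ne.mem_nhds hyx.symm] with x' h1 hx' hne
  refine lt_of_le_of_lt (csInf_le (bddBelow_quotient hΩo hΩb hα0 hα1 hφ hφc hx') ?_) h1
  exact ⟨y, ⟨hy, Ne.symm hne⟩, rfl⟩

/-- `L[φ]` is upper semicontinuous at interior points when `φ` is `C¹`. -/
lemma eventually_Lop_lt (hn : 1 ≤ n) (hΩo : IsOpen Ω) (hΩb : Bornology.IsBounded Ω)
    (hα0 : 0 < α) (hα1 : α ≤ 1) (hφ : ContDiffOn ℝ 1 φ Ω) (hφc : ContinuousOn φ (closure Ω))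
    (hx : x ∈ Ω) {c : ℝ} (hc : Lop Ω α φ x < c) :
    ∀ᶠ x' in 𝓝 x, Lop Ω α φ x' < c := by
  have hε : 0 < (c - Lop Ω α φ x) / 2 := by linarith
  filter_upwards [eventually_Lplus_le hn hΩo hΩb hα0 hα1 hφ hφc hx hε,
    eventually_Lminus_lt hn hΩo hΩb hα0 hα1 hφ hφc hx hε] with x' h1 h2
  unfold Lop at *
  linarith

/-- Adding a small quadratic bump at `x` changes `L[φ](x)` by little. -/
lemma exists_Lop_add_sq_le (hn : 1 ≤ n) (hΩo : IsOpen Ω) (hΩb : Bornology.IsBounded Ω)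
    (hα0 : 0 < α) (hα1 : α ≤ 1) (hφ : ContDiffOn ℝ 1 φ Ω) (hφc : ContinuousOn φ (closure Ω))
    (hx : x ∈ Ω) :
    ∃ C > 0, ∀ δ ≥ 0, Lop Ω α (fun y => φ y + δ * ‖y - x‖ ^ 2) x ≤ Lop Ω α φ x + δ * C := by
  obtain ⟨R, hR⟩ := hΩb.closure.subset_closedBall x
  set S := max R 1
  have hS1 : 1 ≤ S := le_max_right _ _
  refine ⟨2 * S ^ 2, by positivity, fun δ hδ => ?_⟩
  have hne := closure_diff_singleton_nonempty hn hΩo hx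
  have hquad : ∀ y ∈ closure Ω \ {x}, ‖y - x‖ ^ 2 / ‖y - x‖ ^ α ≤ S ^ 2 := by
    rintro y ⟨hy, hyx⟩
    have hpos : 0 < ‖y - x‖ := norm_pos_iff.2 (sub_ne_zero.2 hyx)
    have hyS : ‖y - x‖ ≤ S := by
      rw [← dist_eq_norm]
      exact (mem_closedBall.1 (hR hy)).trans (le_max_left _ _)
    rw [← Real.rpow_natCast, ← Real.rpow_sub hpos, ← Real.rpow_natCast]
    push_cast
    calc ‖y - x‖ ^ (2 - α) ≤ S ^ (2 - α) := Real.rpow_le_rpow hpos.le hyS (by linarith)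
      _ ≤ S ^ (2 : ℝ) := Real.rpow_le_rpow_of_exponent_le hS1 (by linarith)
  have hq : ∀ y ∈ closure Ω \ {x},
      (φ y + δ * ‖y - x‖ ^ 2 - (φ x + δ * ‖x - x‖ ^ 2)) / ‖y - x‖ ^ α ≤
        (φ y - φ x) / ‖y - x‖ ^ α + δ * S ^ 2 := by
    intro y hy
    have h := mul_le_mul_of_nonneg_left (hquad y hy) hδ
    have e : (φ y + δ * ‖y - x‖ ^ 2 - (φ x + δ * ‖x - x‖ ^ 2)) / ‖y - x‖ ^ α =
        (φ y - φ x) / ‖y - x‖ ^ α + δ * (‖y - x‖ ^ 2 / ‖y - x‖ ^ α) := by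
      rw [sub_self, norm_zero]; ring
    rw [e]
    linarith
  have hψ : ContDiffOn ℝ 1 (fun y => φ y + δ * ‖y - x‖ ^ 2) Ω :=
    hφ.add (contDiff_const.mul ((contDiff_id.sub contDiff_const).norm_sq ℝ)).contDiffOn
  have hψc : ContinuousOn (fun y => φ y + δ * ‖y - x‖ ^ 2) (closure Ω) :=
    hφc.add (by fun_prop)
  have hplus : Lplus Ω α (fun y => φ y + δ * ‖y - x‖ ^ 2) x ≤ Lplus Ω α φ x + δ * S ^ 2 := by
    refine csSup_le (hne.image _) ?_
    rintro _ ⟨y, hy, rfl⟩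
    have := le_csSup (bddAbove_quotient hΩo hΩb hα0 hα1 hφ hφc hx) ⟨y, hy, rfl⟩
    exact (hq y hy).trans (add_le_add_left this _)
  have hminus : Lminus Ω α (fun y => φ y + δ * ‖y - x‖ ^ 2) x - δ * S ^ 2 ≤
      Lminus Ω α φ x := by
    refine le_csInf (hne.image _) ?_
    rintro _ ⟨y, hy, rfl⟩
    have := csInf_le (bddBelow_quotient hΩo hΩb hα0 hα1 hψ hψc hx) ⟨y, hy, rfl⟩
    exact sub_le_iff_le_add.2 (this.trans (hq y hy))
  unfold Lop
  linarith

end HolderQuotient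

/-- Stability of subsolutions: if `f` is continuous, `F` is a nonempty family
of viscosity subsolutions of `L[u] = f(u)` on `Ω`, and `v(x) = sup {u(x) : u ∈ F}`
is finite everywhere (`IsLUB`), upper semicontinuous on `Ω̄` and continuous on
`Ω`, then `v` is a viscosity subsolution on `Ω`. -/
theorem stmt_11 (n : ℕ) (hn : 1 ≤ n) (Ω : Set (EuclideanSpace ℝ (Fin n)))
    (hΩo : IsOpen Ω) (hΩne : Ω.Nonempty) (hΩb : Bornology.IsBounded Ω)
    (α : ℝ) (hα0 : 0 < α) (hα1 : α ≤ 1)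
    (f : ℝ → ℝ) (hf : Continuous f)
    (F : Set (EuclideanSpace ℝ (Fin n) → ℝ)) (hFne : F.Nonempty)
    (hF : ∀ u ∈ F, IsViscositySubsolution Ω Ω α f u)
    (v : EuclideanSpace ℝ (Fin n) → ℝ)
    (hv : ∀ x ∈ closure Ω, IsLUB ((fun u : EuclideanSpace ℝ (Fin n) → ℝ => u x) '' F) (v x))
    (hvusc : UpperSemicontinuousOn v (closure Ω))
    (hvc : ContinuousOn v Ω) :
    IsViscositySubsolution Ω Ω α f v := by
  refine ⟨hvusc, fun φ hφ hφc hvφ x₀ hx₀ hvx₀ => ?_⟩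
  by_contra! hcon
  obtain ⟨C, hC, hCδ⟩ := exists_Lop_add_sq_le hn hΩo hΩb hα0 hα1 hφ hφc hx₀
  set gap := f (φ x₀) - Lop Ω α φ x₀ with hgap
  have hgap0 : 0 < gap := by linarith
  set δ := gap / (4 * C) with hδdef
  have hδ : 0 < δ := by positivity
  have hδC : δ * C = gap / 4 := by rw [hδdef]; field_simp
  set ψ : EuclideanSpace ℝ (Fin n) → ℝ := fun y => φ y + δ * ‖y - x₀‖ ^ 2 with hψdef
  have hψ : ContDiffOn ℝ 1 ψ Ω :=
    hφ.add (contDiff_const.mul ((contDiff_id.sub contDiff_const).norm_sq ℝ)).contDiffOn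
  have hψc : ContinuousOn ψ (closure Ω) := hφc.add (by fun_prop)
  have hψx₀ : ψ x₀ = φ x₀ := by simp [hψdef]
  have hψL : Lop Ω α ψ x₀ < f (φ x₀) - gap / 2 := by
    have := hCδ δ hδ.le
    linarith
  have hev1 := eventually_Lop_lt hn hΩo hΩb hα0 hα1 hψ hψc hx₀ hψL
  have hψcx : ContinuousAt ψ x₀ := hψ.continuousOn.continuousAt (hΩo.mem_nhds hx₀)
  have htf : Tendsto (fun z : EuclideanSpace ℝ (Fin n) × ℝ => f (ψ z.1 + z.2))
      (𝓝 x₀ ×ˢ 𝓝 0) (𝓝 (f (φ x₀))) := by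
    refine (hf.tendsto _).comp ?_
    simpa [hψx₀] using (hψcx.tendsto.comp tendsto_fst).add
      (tendsto_snd (f := 𝓝 x₀) (g := 𝓝 (0 : ℝ)))
  have hev2 := htf.eventually_const_lt (show f (φ x₀) - gap / 2 < f (φ x₀) by linarith)
  obtain ⟨P, hP, Q, hQ, hPQ⟩ := eventually_prod_iff.1 hev2
  obtain ⟨r, hr, hball⟩ := Metric.eventually_nhds_iff.1
    ((hev1.and hP).and (hΩo.mem_nhds hx₀))
  obtain ⟨η, hη, hηQ⟩ := Metric.eventually_nhds_iff.1 hQ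
  have hx₀c : x₀ ∈ closure Ω := subset_closure hx₀
  have hm : 0 < min η (δ * r ^ 2) := by positivity
  obtain ⟨_, ⟨u, hu, rfl⟩, hlt, -⟩ :=
    (hv x₀ hx₀c).exists_between (sub_lt_self (v x₀) hm)
  obtain ⟨x₁, hx₁, hmax⟩ := UpperSemicontinuousOn.exists_isMaxOn ⟨x₀, hx₀c⟩
    hΩb.isCompact_closure ((hF u hu).1.add hψc.neg.upperSemicontinuousOn)
  have hux₁ : u x₁ ≤ φ x₁ := ((hv x₁ hx₁).1 ⟨u, hu, rfl⟩).trans (hvφ x₁ hx₁)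
  set M := u x₁ - ψ x₁ with hMdef
  have hMge : ∀ y ∈ closure Ω, u y - ψ y ≤ M := by
    intro y hy
    have h : u y + -ψ y ≤ u x₁ + -ψ x₁ := hmax hy
    linarith
  have hMlow := hMge x₀ hx₀c
  have hMup : M ≤ -(δ * ‖x₁ - x₀‖ ^ 2) := by
    simp only [hMdef, hψdef]
    linarith
  have hsq := mul_nonneg hδ.le (sq_nonneg ‖x₁ - x₀‖)
  have hminl := min_le_left η (δ * r ^ 2)
  have hminr := min_le_right η (δ * r ^ 2)
  dsimp only at hlt
  have hdist : dist x₁ x₀ < r := by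
    rw [dist_eq_norm]
    refine lt_of_pow_lt_pow_left₀ 2 hr.le (lt_of_mul_lt_mul_left ?_ hδ.le)
    linarith
  obtain ⟨⟨hL, hPx⟩, hx₁Ω⟩ := hball hdist
  have hQM : Q M := hηQ (by
    rw [Real.dist_eq, sub_zero, abs_lt]
    constructor <;> linarith)
  have hfM := hPQ hPx hQM
  have hsub := (hF u hu).2 (fun y => ψ y + M) (hψ.add contDiffOn_const)
    (hψc.add continuousOn_const) (fun y hy => by linarith [hMge y hy]) x₁ hx₁Ω
    (by linarith)
  rw [Lop_add_const] at hsub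
  linarith
end
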